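/- (Pointwise Lyapunov inequality underlying Proposition 1.) Assume there exist λ > 0 and δ₀ > 0 such that for every p ∈ ℝ^(2n) with z = B̄ᵀp and ‖e(z)‖ ≤ δ₀ one has xᵀ(D_zᵀ B̄ᵀ B̄ D_z)x ≥ λ‖x‖² for all x ∈ ℝ^m. Then there exists σ₀ ∈ ℕ such that for every significant-figures parameter σ ≥ σ₀ there exists k > 0 with the following property: for every p ∈ ℝ^(2n) with z = B̄ᵀp and ‖e(z)‖ ≤ δ₀, letting e = e(z), one has e ᵀ D_zᵀ B̄ᵀ B̄ D_{Q(z)} Q(e) ≥ k‖e‖² (i.e. the Lyapunov function V = ¼‖e‖² has derivative along the quantized closed loop bounded by −k‖e‖²). -/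

import Mathlib

open Matrix

/-- Base-10 scaling factor of the mixed uniform-logarithmic quantizer (MULQ):
`S(x) = 10^(σ - ⌊log₁₀ |x|⌋ - 1)`. -/
noncomputable def mulqS (σ : ℕ) (x : ℝ) : ℝ :=
  (10 : ℝ) ^ ((σ : ℤ) - ⌊Real.logb 10 |x|⌋ - 1)

/-- The mixed uniform-logarithmic quantizer: `Q(x) = (1/S(x)) ⬝ round (S(x)·x)`, `Q(0) = 0`. -/
noncomputable def mulqQ (σ : ℕ) (x : ℝ) : ℝ :=
  if x = 0 then 0 else (round (mulqS σ x * x) : ℤ) / mulqS σ x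

/-- `B̄ = B ⊗ I₂`. -/
noncomputable def Bbar {n m : ℕ} (B : Matrix (Fin n) (Fin m) ℝ) :
    Matrix (Fin n × Fin 2) (Fin m × Fin 2) ℝ :=
  Matrix.kroneckerMap (· * ·) B (1 : Matrix (Fin 2) (Fin 2) ℝ)

/-- The column of `B` at edge `k` has exactly one `+1` entry, one `−1` entry, and zeros
elsewhere: `B` is the incidence matrix of an undirected graph with `n` nodes and `m` edges. -/
def IsIncidence {n m : ℕ} (B : Matrix (Fin n) (Fin m) ℝ) : Prop :=
  ∀ k : Fin m, ∃ i j : Fin n, i ≠ j ∧ B i k = 1 ∧ B j k = -1 ∧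
    ∀ l : Fin n, l ≠ i → l ≠ j → B l k = 0

/-- Distance error vector `e(z)`, with components `e_k = ‖z_k‖² − d_k²`. -/
def errVec {m : ℕ} (d : Fin m → ℝ) (z : Fin m × Fin 2 → ℝ) : Fin m → ℝ :=
  fun k => ((z (k, 0)) ^ 2 + (z (k, 1)) ^ 2) - (d k) ^ 2

/-- The `2m × m` block-diagonal matrix `D_z` whose `k`-th diagonal block is `z_k ∈ ℝ²`. -/
def blockDiag {m : ℕ} (z : Fin m × Fin 2 → ℝ) : Matrix (Fin m × Fin 2) (Fin m) ℝ :=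
  fun p k => if p.1 = k then z p else 0

/-- Euclidean norm of a finitely-indexed real vector. -/
noncomputable def euclNorm {ι : Type*} [Fintype ι] (x : ι → ℝ) : ℝ :=
  Real.sqrt (∑ i, (x i) ^ 2)

lemma mulqS_pos (σ : ℕ) (x : ℝ) : 0 < mulqS σ x := by
  unfold mulqS; positivity

/-- The MULQ has relative error at most `5 * 10⁻σ`. -/
lemma abs_mulqQ_sub_le (σ : ℕ) (x : ℝ) :
    |mulqQ σ x - x| ≤ 5 * (1 / 10 : ℝ) ^ σ * |x| := by
  rcases eq_or_ne x 0 with rfl | hx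
  · simp [mulqQ]
  have hS := mulqS_pos σ x
  have hx' : 0 < |x| := abs_pos.mpr hx
  have hpow : (10 : ℝ) ^ ⌊Real.logb 10 |x|⌋ ≤ |x| := by
    rw [← Real.rpow_intCast, ← Real.le_logb_iff_rpow_le (by norm_num) hx']
    exact Int.floor_le _
  have hinv : (mulqS σ x)⁻¹ = 10 * (1 / 10 : ℝ) ^ σ * (10 : ℝ) ^ ⌊Real.logb 10 |x|⌋ := by
    unfold mulqS
    rw [zpow_sub₀ (by norm_num), zpow_sub₀ (by norm_num), zpow_natCast, zpow_one, one_div,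
      inv_pow]
    field_simp
  have hsub : mulqQ σ x - x
      = ((round (mulqS σ x * x) : ℤ) - mulqS σ x * x) * (mulqS σ x)⁻¹ := by
    rw [mulqQ, if_neg hx]
    field_simp
  have hround : |((round (mulqS σ x * x) : ℤ) : ℝ) - mulqS σ x * x| ≤ 1 / 2 := by
    rw [abs_sub_comm]
    exact abs_sub_round _
  rw [hsub, abs_mul, abs_of_pos (inv_pos.mpr hS)]
  calc _ ≤ 1 / 2 * (mulqS σ x)⁻¹ := by gcongr
    _ = 5 * (1 / 10 : ℝ) ^ σ * (10 : ℝ) ^ ⌊Real.logb 10 |x|⌋ := by rw [hinv]; ring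
    _ ≤ _ := by gcongr

/-- Relative errors at most `ε ≤ 1` in two factors give a relative error at most `3 * ε` in
their product. -/
lemma abs_mul_sub_mul_le {ε a b a' b' : ℝ} (hε₁ : ε ≤ 1)
    (ha : |a' - a| ≤ ε * |a|) (hb : |b' - b| ≤ ε * |b|) :
    |a' * b' - a * b| ≤ 3 * ε * (|a| * |b|) := by
  have ha₁ : |a' - a| ≤ |a| := ha.trans (mul_le_of_le_one_left (abs_nonneg a) hε₁)
  calc |a' * b' - a * b| = |(a' - a) * (b' - b) + ((a' - a) * b + a * (b' - b))| := by
        congr 1; ring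
    _ ≤ |a' - a| * |b' - b| + (|a' - a| * |b| + |a| * |b' - b|) := by
        refine (abs_add_le _ _).trans (add_le_add (abs_mul _ _).le ?_)
        exact (abs_add_le _ _).trans (add_le_add (abs_mul _ _).le (abs_mul _ _).le)
    _ ≤ |a| * (ε * |b|) + (ε * |a| * |b| + |a| * (ε * |b|)) := by gcongr
    _ = 3 * ε * (|a| * |b|) := by ring

lemma abs_le_euclNorm {ι : Type*} [Fintype ι] (x : ι → ℝ) (i : ι) : |x i| ≤ euclNorm x :=
  Real.abs_le_sqrt
    (Finset.single_le_sum (f := fun j => x j ^ 2) (fun _ _ => sq_nonneg _) (Finset.mem_univ i))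

lemma blockDiag_mulVec {m : ℕ} (z : Fin m × Fin 2 → ℝ) (x : Fin m → ℝ) :
    (blockDiag z).mulVec x = fun p => z p * x p.1 := by
  ext p
  simp [_root_.blockDiag, Matrix.mulVec, dotProduct]

lemma dotProduct_blockDiag_mulVec {m : ℕ} {ι : Type*} [Fintype ι]
    (A : Matrix ι (Fin m × Fin 2) ℝ) (z w : Fin m × Fin 2 → ℝ) (x y : Fin m → ℝ) :
    x ⬝ᵥ ((blockDiag z)ᵀ * Aᵀ * A * blockDiag w).mulVec y
      = (fun p => z p * x p.1) ⬝ᵥ (Aᵀ * A).mulVec (fun p => w p * y p.1) := by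
  rw [← blockDiag_mulVec, ← blockDiag_mulVec, Matrix.mul_assoc (blockDiag z)ᵀ,
    Matrix.mul_assoc, ← Matrix.mulVec_mulVec, ← Matrix.mulVec_mulVec, Matrix.dotProduct_mulVec,
    Matrix.vecMul_transpose]

lemma abs_dotProduct_mulVec_le {ι κ : Type*} [Fintype ι] [Fintype κ] (G : Matrix ι κ ℝ)
    {v : ι → ℝ} {u : κ → ℝ} {a b : ℝ}
    (hv : ∀ i, |v i| ≤ a) (hu : ∀ j, |u j| ≤ b) :
    |v ⬝ᵥ G.mulVec u| ≤ (∑ i, ∑ j, |G i j|) * (a * b) := by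
  simp only [dotProduct, Matrix.mulVec, Finset.mul_sum, Finset.sum_mul]
  refine (Finset.abs_sum_le_sum_abs _ _).trans (Finset.sum_le_sum fun i _ => ?_)
  refine (Finset.abs_sum_le_sum_abs _ _).trans (Finset.sum_le_sum fun j _ => ?_)
  have ha : 0 ≤ a := (abs_nonneg _).trans (hv i)
  calc |v i * (G i j * u j)| = |G i j| * (|v i| * |u j|) := by
        rw [abs_mul, abs_mul]; ring
    _ ≤ |G i j| * (a * b) := by
        gcongr
        exacts [hv i, hu j]

lemma sq_le_of_euclNorm_errVec_le {m : ℕ} {d : Fin m → ℝ} {z : Fin m × Fin 2 → ℝ} {δ : ℝ}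
    (h : euclNorm (errVec d z) ≤ δ) (p : Fin m × Fin 2) :
    z p ^ 2 ≤ ∑ k, d k ^ 2 + δ := by
  obtain ⟨k, i⟩ := p
  have h₁ : errVec d z k ≤ δ := (le_abs_self _).trans ((abs_le_euclNorm _ k).trans h)
  have h₂ : d k ^ 2 ≤ ∑ l, d l ^ 2 :=
    Finset.single_le_sum (f := fun l => d l ^ 2) (fun _ _ => sq_nonneg _) (Finset.mem_univ k)
  simp only [errVec] at h₁
  fin_cases i
  · simp only [Fin.zero_eta]
    nlinarith [sq_nonneg (z (k, 1))]
  · simp only [Fin.mk_one]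
    nlinarith [sq_nonneg (z (k, 0))]

/-- Pointwise Lyapunov inequality underlying Proposition 1: if `D_zᵀB̄ᵀB̄D_z ⪰ λI` on the set
where `‖e(z)‖ ≤ δ₀`, then for all sufficiently large significant-figures parameters `σ` there
is `k > 0` such that `eᵀD_zᵀB̄ᵀB̄D_{Q(z)}Q(e) ≥ k‖e‖²` on that set. -/
theorem quantized_lyapunov_inequality (n m : ℕ) (hn : 2 ≤ n) (hm : 1 ≤ m)
    (B : Matrix (Fin n) (Fin m) ℝ) (hB : IsIncidence B)
    (d : Fin m → ℝ) (hd : ∀ k, 0 < d k)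
    (lam δ₀ : ℝ) (hlam : 0 < lam) (hδ₀ : 0 < δ₀)
    (hpd : ∀ p : Fin n × Fin 2 → ℝ,
      euclNorm (errVec d ((Bbar B)ᵀ.mulVec p)) ≤ δ₀ →
      ∀ x : Fin m → ℝ,
        x ⬝ᵥ ((blockDiag ((Bbar B)ᵀ.mulVec p))ᵀ * (Bbar B)ᵀ * Bbar B
            * blockDiag ((Bbar B)ᵀ.mulVec p)).mulVec x
          ≥ lam * euclNorm x ^ 2) :
    ∃ σ₀ : ℕ, ∀ σ : ℕ, σ₀ ≤ σ → ∃ k : ℝ, 0 < k ∧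
      ∀ p : Fin n × Fin 2 → ℝ,
        euclNorm (errVec d ((Bbar B)ᵀ.mulVec p)) ≤ δ₀ →
        (errVec d ((Bbar B)ᵀ.mulVec p)) ⬝ᵥ
            ((blockDiag ((Bbar B)ᵀ.mulVec p))ᵀ * (Bbar B)ᵀ * Bbar B
              * blockDiag (fun p2 => mulqQ σ ((Bbar B)ᵀ.mulVec p p2))).mulVec
            (fun k => mulqQ σ (errVec d ((Bbar B)ᵀ.mulVec p) k))
          ≥ k * euclNorm (errVec d ((Bbar B)ᵀ.mulVec p)) ^ 2 := by
  set M : ℝ := ∑ k, d k ^ 2 + δ₀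
  have hM₀ : 0 < M := add_pos_of_nonneg_of_pos (Finset.sum_nonneg fun _ _ => sq_nonneg _) hδ₀
  set K : ℝ := ∑ i, ∑ j, |((Bbar B)ᵀ * Bbar B) i j|
  have hK₀ : 0 ≤ K := Finset.sum_nonneg fun _ _ => Finset.sum_nonneg fun _ _ => abs_nonneg _
  have hc : 0 < min (1 / 5) (lam / (30 * (K * M + 1))) := by positivity
  obtain ⟨σ₀, hσ₀⟩ := exists_pow_lt_of_lt_one hc (by norm_num : (1 / 10 : ℝ) < 1)
  refine ⟨σ₀, fun σ hσ => ⟨lam / 2, by positivity, fun p hp => ?_⟩⟩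
  have hσlt : (1 / 10 : ℝ) ^ σ < min (1 / 5) (lam / (30 * (K * M + 1))) :=
    (pow_le_pow_of_le_one (by norm_num) (by norm_num) hσ).trans_lt hσ₀
  have hpd_p := hpd p hp
  set z := (Bbar B)ᵀ.mulVec p
  set e := errVec d z
  set ε : ℝ := 5 * (1 / 10 : ℝ) ^ σ with hε
  have hε₀ : 0 ≤ ε := by positivity
  have hε₁ : ε ≤ 1 := by linarith [hσlt.trans_le (min_le_left _ _)]
  have hεK : 3 * ε * (K * M) ≤ lam / 2 := by
    have h := (hσlt.trans_le (min_le_right _ _)).le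
    rw [le_div_iff₀ (by positivity)] at h
    have hpow : (0 : ℝ) ≤ (1 / 10 : ℝ) ^ σ := by positivity
    nlinarith
  have hzM : ∀ q, |z q| ≤ √M := fun q => Real.abs_le_sqrt (sq_le_of_euclNorm_errVec_le hp q)
  have hv : ∀ q : Fin m × Fin 2, |z q| * |e q.1| ≤ √M * euclNorm e := fun q =>
    mul_le_mul (hzM q) (abs_le_euclNorm e q.1) (abs_nonneg _) (Real.sqrt_nonneg _)
  have hmain := hpd_p e
  rw [dotProduct_blockDiag_mulVec] at hmain ⊢
  have hsplit : (fun q : Fin m × Fin 2 => mulqQ σ (z q) * mulqQ σ (e q.1))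
      = (fun q => z q * e q.1) + fun q => mulqQ σ (z q) * mulqQ σ (e q.1) - z q * e q.1 := by
    ext q; simp
  have herr := abs_dotProduct_mulVec_le ((Bbar B)ᵀ * Bbar B)
    (v := fun q => z q * e q.1)
    (u := fun q => mulqQ σ (z q) * mulqQ σ (e q.1) - z q * e q.1)
    (a := √M * euclNorm e) (b := 3 * ε * (√M * euclNorm e))
    (fun q => (abs_mul _ _).trans_le (hv q))
    (fun q => (abs_mul_sub_mul_le hε₁ (abs_mulqQ_sub_le σ _) (abs_mulqQ_sub_le σ _)).trans
      (mul_le_mul_of_nonneg_left (hv q) (by positivity)))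
  have hbound : K * (√M * euclNorm e * (3 * ε * (√M * euclNorm e)))
      ≤ lam / 2 * euclNorm e ^ 2 := by
    calc _ = 3 * ε * (K * √M ^ 2) * euclNorm e ^ 2 := by ring
      _ = 3 * ε * (K * M) * euclNorm e ^ 2 := by rw [Real.sq_sqrt hM₀.le]
      _ ≤ _ := by gcongr
  rw [hsplit, Matrix.mulVec_add, dotProduct_add]
  linarith [(abs_le.mp (herr.trans hbound)).1]
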